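/- Let ξ ∈ (0,1), m > 0, Δ ≥ d³m²/ξ², and M ≥ √(8Δ log(8d/ξ)). Define g(z) = (2πΔ)^{-d/2} exp(-(‖z‖_2 + m√d/2)²/(2Δ)) (1 - 2d e^{-3M²/(2Δ)}) for z in the cube [-M/2, M/2]^d and g(z) = 0 otherwise. Then ∫_{[-(M-m)/2,(M-m)/2]^d} g(z) dz ≥ 1 - ξ. -/

import Mathlib

open MeasureTheory Real

lemma aux_sq {x y : ℝ} (h : x ^ 2 ≤ y ^ 2) (hy : 0 ≤ y) : x ≤ y := by
  by_contra hh
  push Not at hh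
  nlinarith

lemma aux_tail (b t : ℝ) (hb : 0 < b) (ht : 0 ≤ t) :
    ∫ x in Set.Ioi t, rexp (-b * x ^ 2) ≤ rexp (-b * t ^ 2) * (√(π / b) / 2) := by
  have h := (measurePreserving_add_right volume t).setIntegral_preimage_emb
    (measurableEmbedding_addRight t) (fun x => rexp (-b * x ^ 2)) (Set.Ioi t)
  rw [← h, ← integral_gaussian_Ioi b, ← integral_const_mul]
  have hs : (fun x => x + t) ⁻¹' Set.Ioi t = Set.Ioi (0:ℝ) := by
    ext x; simp
  rw [hs]
  have hi : Integrable (fun x : ℝ => rexp (-b * x ^ 2)) := integrable_exp_neg_mul_sq hb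
  refine setIntegral_mono_on ?_ ?_ measurableSet_Ioi ?_
  · exact (hi.comp_add_right t).integrableOn
  · exact (hi.const_mul _).integrableOn
  · intro x hx
    have hx : 0 < x := hx
    rw [← Real.exp_add]
    apply Real.exp_le_exp.2
    have : 0 ≤ b * (x * t) := by positivity
    nlinarith

lemma aux_one (b a c : ℝ) (hb : 0 < b) (ha : 0 ≤ a) (hc : 0 ≤ c) :
    √(π / b) - 2 * a - √(π / b) * rexp (-b * (a + c) ^ 2) ≤
      ∫ x in Set.Icc (-c) c, rexp (-b * (|x| + a) ^ 2) := by
  have hi : Integrable (fun x : ℝ => rexp (-b * x ^ 2)) := integrable_exp_neg_mul_sq hb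
  have hcont : Continuous (fun x : ℝ => rexp (-b * (|x| + a) ^ 2)) := by fun_prop
  have hcont' : Continuous (fun x : ℝ => rexp (-b * x ^ 2)) := by fun_prop
  have e1 : ∫ x in Set.Icc (-c) c, rexp (-b * (|x| + a) ^ 2)
      = ∫ x in (-c)..c, rexp (-b * (|x| + a) ^ 2) := by
    rw [intervalIntegral.integral_of_le (by linarith), integral_Icc_eq_integral_Ioc]
  have e2 : ∫ x in (-c)..c, rexp (-b * (|x| + a) ^ 2) =
      2 * ∫ x in (0:ℝ)..c, rexp (-b * (|x| + a) ^ 2) := by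
    rw [← intervalIntegral.integral_add_adjacent_intervals (hcont.intervalIntegrable (-c) 0)
      (hcont.intervalIntegrable 0 c)]
    have := intervalIntegral.integral_comp_neg (a := 0) (b := c)
      (fun x => rexp (-b * (|x| + a) ^ 2))
    simp only [abs_neg, neg_zero] at this
    rw [← this]; ring
  have e3 : ∫ x in (0:ℝ)..c, rexp (-b * (|x| + a) ^ 2) =
      ∫ x in a..(c + a), rexp (-b * x ^ 2) := by
    have := intervalIntegral.integral_comp_add_right (a := 0) (b := c)
      (fun x => rexp (-b * x ^ 2)) a
    rw [zero_add] at this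
    rw [← this]
    refine intervalIntegral.integral_congr ?_
    intro x hx
    rw [Set.uIcc_of_le hc] at hx
    simp only [abs_of_nonneg hx.1]
  have e4 := intervalIntegral.integral_add_adjacent_intervals
    (hcont'.intervalIntegrable (μ := volume) 0 a) (hcont'.intervalIntegrable a (c + a))
  have e5 := intervalIntegral.integral_interval_add_Ioi (a := 0) (b := c + a)
    hi.integrableOn hi.integrableOn
  have e6 := aux_tail b (c + a) hb (by linarith)
  rw [integral_gaussian_Ioi] at e5
  have e7 : ∫ x in (0:ℝ)..a, rexp (-b * x ^ 2) ≤ a := by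
    have := intervalIntegral.integral_mono_on (μ := volume) ha
      (hcont'.intervalIntegrable 0 a) (g := fun _ => (1:ℝ)) (by simp)
      (fun x _ => by
        apply Real.exp_le_one_iff.2
        have : 0 ≤ b * x ^ 2 := by positivity
        linarith)
    simpa using this
  rw [e1, e2, e3, add_comm a c]
  nlinarith

lemma aux_prod (d : ℕ) (b a c : ℝ) (hb : 0 < b) (ha : 0 ≤ a) (hd : 1 ≤ d) :
    (∫ x in Set.Icc (-c) c, rexp (-b * (|x| + a) ^ 2)) ^ d ≤
    ∫ z in {z : EuclideanSpace ℝ (Fin d) | ∀ i, |z i| ≤ c}, rexp (-b * (‖z‖ + a) ^ 2) := by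
  have h := (PiLp.volume_preserving_toLp (Fin d)).setIntegral_preimage_emb
    (MeasurableEquiv.toLp 2 (Fin d → ℝ)).measurableEmbedding
    (fun z => rexp (-b * (‖z‖ + a) ^ 2)) {z : EuclideanSpace ℝ (Fin d) | ∀ i, |z i| ≤ c}
  rw [← h]
  have hs : (@WithLp.toLp 2 (Fin d → ℝ)) ⁻¹' {z : EuclideanSpace ℝ (Fin d) | ∀ i, |z i| ≤ c}
      = Set.univ.pi (fun _ => Set.Icc (-c) c) := by
    ext x; simp only [Set.mem_preimage, Set.mem_setOf_eq, abs_le, Set.mem_pi, Set.mem_univ,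
      Set.mem_Icc, true_implies]
  rw [hs]
  have hp : ∫ x in Set.univ.pi (fun _ : Fin d => Set.Icc (-c) c),
      ∏ i, rexp (-b * (|x i| + a) ^ 2) =
      (∫ x in Set.Icc (-c) c, rexp (-b * (|x| + a) ^ 2)) ^ d := by
    rw [volume_pi, Measure.restrict_pi_pi,
      integral_fintype_prod_eq_pow (fun x => rexp (-b * (|x| + a) ^ 2)), Fintype.card_fin]
  rw [← hp]
  have hK : IsCompact (Set.univ.pi (fun _ : Fin d => Set.Icc (-c) c)) :=
    isCompact_univ_pi fun _ => isCompact_Icc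
  refine setIntegral_mono_on ?_ ?_ hK.measurableSet ?_
  · exact Continuous.continuousOn (by fun_prop) |>.integrableOn_compact hK
  · exact Continuous.continuousOn (by fun_prop) |>.integrableOn_compact hK
  · intro x _
    rw [← Real.exp_sum]
    apply Real.exp_le_exp.2
    rw [← Finset.mul_sum]
    have h1 : ‖WithLp.toLp 2 x‖ ^ 2 = ∑ i, |x i| ^ 2 := by
      rw [EuclideanSpace.norm_sq_eq]; simp
    have h2 : ‖WithLp.toLp 2 x‖ ≤ ∑ i, |x i| := by
      apply aux_sq _ (Finset.sum_nonneg fun i _ => abs_nonneg _)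
      rw [h1]
      exact Finset.sum_sq_le_sq_sum_of_nonneg (fun i _ => abs_nonneg _)
    have h3 : ∑ i, (|x i| + a) ^ 2 = ∑ i, |x i| ^ 2 + 2 * a * ∑ i, |x i| + d * a ^ 2 := by
      simp_rw [add_sq, Finset.sum_add_distrib, Finset.mul_sum]
      simp
      refine Finset.sum_congr rfl fun i _ => by ring
    have hd' : (1:ℝ) ≤ d := by exact_mod_cast hd
    have h4 : (‖WithLp.toLp 2 x‖ + a) ^ 2 ≤ ∑ i, (|x i| + a) ^ 2 := by
      rw [h3, add_sq, h1]
      have := mul_le_mul_of_nonneg_left h2 ha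
      nlinarith [sq_nonneg a]
    nlinarith

set_option maxHeartbeats 2000000

theorem stmt_12 (d : ℕ) (hd : 1 ≤ d) (ξ m Δ M : ℝ)
    (hξ : ξ ∈ Set.Ioo (0 : ℝ) 1) (hm : 0 < m)
    (hΔ : (d : ℝ) ^ 3 * m ^ 2 / ξ ^ 2 ≤ Δ)
    (hM : Real.sqrt (8 * Δ * Real.log (8 * d / ξ)) ≤ M)
    (g : EuclideanSpace ℝ (Fin d) → ℝ)
    (hg : ∀ z, g z =
      if ∀ i, |z i| ≤ M / 2 then
        (2 * π * Δ) ^ (-(d : ℝ) / 2) * Real.exp (-(‖z‖ + m * Real.sqrt d / 2) ^ 2 / (2 * Δ))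
          * (1 - 2 * d * Real.exp (-3 * M ^ 2 / (2 * Δ)))
      else 0) :
    1 - ξ ≤ ∫ z in {z : EuclideanSpace ℝ (Fin d) | ∀ i, |z i| ≤ (M - m) / 2}, g z := by
  obtain ⟨hξ0, hξ1⟩ := hξ
  have hd' : (1:ℝ) ≤ d := by exact_mod_cast hd
  have hd0 : (0:ℝ) < d := by linarith
  have hΔ0 : 0 < Δ := lt_of_lt_of_le (by positivity) hΔ
  set L := Real.log (8 * d / ξ) with hL
  have h8 : 8 ≤ 8 * d / ξ := by
    rw [le_div_iff₀ hξ0]; nlinarith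
  have hL1 : 1 ≤ L := by
    rw [hL, Real.le_log_iff_exp_le (by positivity)]
    linarith [Real.exp_one_lt_d9]
  have hM0 : 0 ≤ M := (Real.sqrt_nonneg _).trans hM
  have hM2 : 8 * Δ * L ≤ M ^ 2 := (Real.sqrt_le_left hM0).1 hM
  have hexpL : rexp (-L) = ξ / (8 * d) := by
    rw [hL, Real.exp_neg, Real.exp_log (by positivity), inv_div]
  have hΔ' : (d:ℝ) ^ 3 * m ^ 2 ≤ Δ * ξ ^ 2 := (div_le_iff₀ (by positivity)).1 hΔ
  have hmM : m ≤ M := by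
    apply aux_sq _ hM0
    have : m ^ 2 ≤ (d:ℝ) ^ 3 * m ^ 2 := le_mul_of_one_le_left (by positivity) (one_le_pow₀ hd')
    have : Δ * ξ ^ 2 ≤ Δ := mul_le_of_le_one_right hΔ0.le (pow_le_one₀ hξ0.le hξ1.le)
    nlinarith
  set b := 1 / (2 * Δ) with hb
  have hb0 : 0 < b := by positivity
  set a := m * √d / 2 with ha
  have ha0 : 0 ≤ a := by positivity
  set c := (M - m) / 2 with hc
  have hc0 : 0 ≤ c := by rw [hc]; linarith
  set G := √(2 * π * Δ) with hG
  have hG0 : 0 < G := by positivity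
  have hGb : √(π / b) = G := by
    rw [hG, hb]; congr 1; field_simp
  set K := 1 - 2 * d * Real.exp (-3 * M ^ 2 / (2 * Δ)) with hK
  have hML : L ≤ M ^ 2 / (8 * Δ) := by
    rw [le_div_iff₀ (by positivity)]; linarith
  have hK1 : 1 - ξ / 4 ≤ K := by
    have : rexp (-3 * M ^ 2 / (2 * Δ)) ≤ ξ / (8 * d) := by
      rw [← hexpL]; apply Real.exp_le_exp.2
      have : -3 * M ^ 2 / (2 * Δ) = -12 * (M ^ 2 / (8 * Δ)) := by field_simp; ring
      rw [this]; linarith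
    have h2 : 2 * d * rexp (-3 * M ^ 2 / (2 * Δ)) ≤ 2 * d * (ξ / (8 * d)) := by gcongr
    have h3 : 2 * d * (ξ / (8 * d)) = ξ / 4 := by field_simp; norm_num
    rw [hK]; linarith
  have hK0 : 0 ≤ K := by linarith
  -- rewrite the integral
  have hint : ∫ z in {z : EuclideanSpace ℝ (Fin d) | ∀ i, |z i| ≤ c}, g z =
      (G⁻¹) ^ d * K * ∫ z in {z : EuclideanSpace ℝ (Fin d) | ∀ i, |z i| ≤ c},
        rexp (-b * (‖z‖ + a) ^ 2) := by
    rw [← integral_const_mul]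
    refine setIntegral_congr_fun ?_ ?_
    · have : IsClosed {z : EuclideanSpace ℝ (Fin d) | ∀ i, |z i| ≤ c} := by
        simp only [Set.setOf_forall]
        exact isClosed_iInter fun i => isClosed_le (by fun_prop) (by fun_prop)
      exact this.measurableSet
    · intro z hz
      have hz' : ∀ i, |z i| ≤ M / 2 := fun i => (hz i).trans (by rw [hc]; linarith)
      simp only [hg z, if_pos hz']
      have e1 : (2 * π * Δ) ^ (-(d : ℝ) / 2) = (G⁻¹) ^ d := by
        rw [hG, Real.sqrt_eq_rpow, ← Real.rpow_neg (by positivity), ← Real.rpow_natCast,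
          ← Real.rpow_mul (by positivity)]
        congr 1; ring
      have e2 : -(‖z‖ + a) ^ 2 / (2 * Δ) = -b * (‖z‖ + a) ^ 2 := by rw [hb]; ring
      rw [e1, e2]; ring
  rw [hint]
  have hone := aux_one b a c hb0 ha0 hc0
  have hprod := aux_prod d b a c hb0 ha0 hd
  rw [hGb] at hone
  set I := ∫ x in Set.Icc (-c) c, rexp (-b * (|x| + a) ^ 2)
  have htail : rexp (-b * (a + c) ^ 2) ≤ ξ / (8 * d) := by
    rw [← hexpL]; apply Real.exp_le_exp.2
    have h1 : M / 2 ≤ a + c := by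
      have : 1 ≤ √(d:ℝ) := Real.one_le_sqrt.2 hd'
      rw [ha, hc]; nlinarith
    have h2 : (M / 2) ^ 2 ≤ (a + c) ^ 2 := by gcongr
    have h3 : M ^ 2 / (8 * Δ) = b * (M / 2) ^ 2 := by rw [hb]; field_simp; norm_num
    have := mul_le_mul_of_nonneg_left h2 hb0.le
    linarith
  have h2a : 2 * a ≤ G * (ξ / (2 * d)) := by
    apply aux_sq _ (by positivity)
    have e1 : (2 * a) ^ 2 = m ^ 2 * d := by
      rw [ha, mul_div_cancel₀ _ (two_ne_zero), mul_pow, Real.sq_sqrt hd0.le]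
    have e2 : (G * (ξ / (2 * d))) ^ 2 = 2 * π * Δ * ξ ^ 2 / (4 * d ^ 2) := by
      rw [mul_pow, hG, Real.sq_sqrt (by positivity)]; ring
    rw [e1, e2, le_div_iff₀ (by positivity)]
    have : 0 ≤ Δ * ξ ^ 2 := by positivity
    nlinarith [Real.pi_gt_three]
  have hI : 1 - 3 / 4 * ξ / d ≤ G⁻¹ * I := by
    rw [le_inv_mul_iff₀ hG0]
    have h1 := mul_le_mul_of_nonneg_left htail hG0.le
    have h2 : G * (1 - 3 / 4 * ξ / d) ≤ G - G * (ξ / (2 * d)) - G * (ξ / (8 * d)) := by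
      have : G * (1 - 3 / 4 * ξ / d) = G - G * (ξ / (2 * d)) - G * (ξ / (8 * d))
        - G * (ξ / (8 * d)) := by field_simp; ring
      have h0 : 0 ≤ G * (ξ / (8 * d)) := by positivity
      linarith
    linarith
  have hx : 3 / 4 * ξ / d ≤ 1 := by
    rw [div_le_one hd0]; linarith
  have hpow : 1 - 3 / 4 * ξ ≤ (G⁻¹ * I) ^ d := by
    have h1 := one_add_mul_le_pow (a := -(3 / 4 * ξ / d)) (by linarith) d
    have h2 : (1 + -(3 / 4 * ξ / d)) ^ d ≤ (G⁻¹ * I) ^ d := by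
      apply pow_le_pow_left₀ <;> linarith
    have h3 : 1 + (d:ℝ) * -(3 / 4 * ξ / d) = 1 - 3 / 4 * ξ := by field_simp; ring
    linarith
  calc 1 - ξ ≤ (1 - 3 / 4 * ξ) * (1 - ξ / 4) := by nlinarith
    _ ≤ (G⁻¹ * I) ^ d * K := by
      apply mul_le_mul hpow hK1 (by linarith) (by linarith)
    _ = G⁻¹ ^ d * K * I ^ d := by rw [mul_pow]; ring
    _ ≤ _ := by gcongr
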